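/- Soundness of the bare bones system: the inference relation ⊢ is contained in the consequence relation ⊨, i.e. Γ ⊢ (S:P) implies Γ ⊨ (S:P) for all Γ, S, P. -/

import Mathlib

namespace Paper

/-- Terms of the bare bones dependent type system (Part 1): constants `c n`,
variables `v n`, dependent products `ρR`, applications `βRS` and abstractions `λxRS`. -/
inductive Tm : Type
  | const : ℕ → Tm
  | var : ℕ → Tm
  | rho : Tm → Tm
  | app : Tm → Tm → Tm
  | lam : ℕ → Tm → Tm → Tm
  deriving DecidableEq

namespace Tm

/-- The size of a term. -/
def size : Tm → ℕ
  | const _ => 1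
  | var _ => 1
  | rho R => R.size + 1
  | app R S => R.size + S.size + 1
  | lam _ R S => R.size + S.size + 1

/-- The free variables `F(T)` of a term. -/
def fv : Tm → Finset ℕ
  | const _ => ∅
  | var x => {x}
  | rho R => R.fv
  | app R S => R.fv ∪ S.fv
  | lam x R S => R.fv ∪ (S.fv \ {x})

/-- The bound variables `B(T)` of a term. -/
def bv : Tm → Finset ℕ
  | const _ => ∅
  | var _ => ∅
  | rho R => R.bv
  | app R S => R.bv ∪ S.bv
  | lam x R S => (R.bv ∪ S.bv) ∪ {x}

/-- All variables `V(T) = F(T) ∪ B(T)` occurring in a term. -/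
def vars (t : Tm) : Finset ℕ := t.fv ∪ t.bv

/-- A fixed choice of a variable outside a given finite set of variables. -/
def fresh (s : Finset ℕ) : ℕ := s.sup id + 1

theorem fresh_not_mem (s : Finset ℕ) : fresh s ∉ s := by
  intro h
  have := Finset.le_sup (f := id) h
  simp only [id] at this
  simp only [fresh] at this
  omega

/-- Capture-avoiding renaming `S[z/y]` (substitution of the variable `z` for the
variable `y`), implemented with a fuel parameter and carrying the fact that it
preserves the size of the term. -/
def renameAux : (n : ℕ) → (S : Tm) → S.size ≤ n → (z y : ℕ) → {t : Tm // t.size = S.size}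
  | _, const a, _, _, _ => ⟨const a, rfl⟩
  | _, var v, _, z, y => if v = y then ⟨var z, rfl⟩ else ⟨var v, rfl⟩
  | 0, rho _, h, _, _ => absurd h (by simp only [size]; omega)
  | n + 1, rho R, h, z, y =>
      let R' := renameAux n R (by simp only [size] at h; omega) z y
      ⟨rho R'.1, by simp only [size, R'.2]⟩
  | 0, app _ _, h, _, _ => absurd h (by simp only [size]; omega)
  | n + 1, app R S, h, z, y =>
      let R' := renameAux n R (by simp only [size] at h; omega) z y
      let S' := renameAux n S (by simp only [size] at h; omega) z y
      ⟨app R'.1 S'.1, by simp only [size, R'.2, S'.2]⟩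
  | 0, lam _ _ _, h, _, _ => absurd h (by simp only [size]; omega)
  | n + 1, lam w R S, h, z, y =>
      let R' := renameAux n R (by simp only [size] at h; omega) z y
      if w = y ∨ y ∉ S.fv then
        ⟨lam w R'.1 S, by simp only [size, R'.2]⟩
      else if w ≠ z then
        -- here `w ∉ F(z)`, so the chosen fresh variable is `w` itself
        let S' := renameAux n S (by simp only [size] at h; omega) z y
        ⟨lam w R'.1 S'.1, by simp only [size, R'.2, S'.2]⟩
      else
        let z' := fresh ((var z).vars ∪ S.vars)
        let S₁ := renameAux n S (by simp only [size] at h; omega) z' w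
        let S₂ := renameAux n S₁.1 (by rw [S₁.2]; simp only [size] at h; omega) z y
        ⟨lam z' R'.1 S₂.1, by simp only [size, S₂.2, S₁.2, R'.2]⟩

/-- Capture-avoiding renaming `S[z/y]` of the variable `y` to the variable `z`. -/
def rename (S : Tm) (z y : ℕ) : Tm := (renameAux S.size S le_rfl z y).1

theorem size_rename (S : Tm) (z y : ℕ) : (rename S z y).size = S.size :=
  (renameAux S.size S le_rfl z y).2

/-- Capture-avoiding substitution `S[T/x]` of the term `T` for the variable `x` in `S`,
renaming bound variables (using the fixed choice `fresh`) to avoid capture. -/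
def subst : Tm → Tm → ℕ → Tm
  | const a, _, _ => const a
  | var v, T, x => if v = x then T else var v
  | rho R, T, x => rho (subst R T x)
  | app R S, T, x => app (subst R T x) (subst S T x)
  | lam w R S, T, x =>
      if w = x ∨ x ∉ S.fv then lam w (subst R T x) S
      else if w ∉ T.fv then lam w (subst R T x) (subst S T x)
      else lam (fresh (T.vars ∪ S.vars)) (subst R T x)
        (subst (rename S (fresh (T.vars ∪ S.vars)) w) T x)
termination_by S _ _ => S.size
decreasing_by all_goals (simp only [size, size_rename]; omega)

end Tm

end Paper
namespace Paper

open ZFSet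

/-- The application `R(s) = ⋃ R{s} = ⋃ {r | ⟨r,s⟩ ∈ R}` of a set to a set
(ordered pairs `⟨r,s⟩` are Kuratowski pairs `ZFSet.pair r s`). -/
noncomputable def sApp (R s : ZFSet.{0}) : ZFSet :=
  ⋃₀ (ZFSet.sep (fun r => ZFSet.pair r s ∈ R) (⋃₀ (⋃₀ R)))

/-- The domain `dom(S) = {d | ∃ r, ⟨r,d⟩ ∈ S}` of a set. -/
noncomputable def sDom (S : ZFSet.{0}) : ZFSet :=
  ZFSet.sep (fun d => ∃ r, ZFSet.pair r d ∈ S) (⋃₀ (⋃₀ S))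

/-- The range `ran(S) = {r | ∃ d, ⟨r,d⟩ ∈ S}` of a set. -/
noncomputable def sRan (S : ZFSet.{0}) : ZFSet :=
  ZFSet.sep (fun r => ∃ d, ZFSet.pair r d ∈ S) (⋃₀ (⋃₀ S))

/-- `F` is a function: a set of ordered pairs `⟨value, argument⟩` which, for each
`d` in its domain, contains a unique pair with second component `d`. -/
def IsFun (F : ZFSet.{0}) : Prop :=
  (∀ p ∈ F, ∃ r d, p = ZFSet.pair r d) ∧
    ∀ d r r', ZFSet.pair r d ∈ F → ZFSet.pair r' d ∈ F → r = r'

/-- The dependent product `∏F`: the set of all functions `f` with `dom f = dom F`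
such that `f(d) ∈ F(d)` for every `d ∈ dom F` (with the paper's convention that
functions are sets of pairs `⟨value, argument⟩`). -/
noncomputable def dprod (F : ZFSet.{0}) : ZFSet :=
  ZFSet.sep
    (fun f => IsFun f ∧ sDom f = sDom F ∧ ∀ d ∈ sDom F, sApp f d ∈ sApp F d)
    (ZFSet.powerset (ZFSet.prod (⋃₀ (sRan F)) (sDom F)))

/-- The set `{⟨f r, r⟩ : r ∈ X}`, i.e. the graph (in the paper's convention) of the
function sending each `r ∈ X` to `f r`. -/
noncomputable def lamSet (X : ZFSet.{0}) (f : ZFSet.{0} → ZFSet.{0}) : ZFSet :=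
  @ZFSet.image (fun r => ZFSet.pair (f r) r) (Classical.allZFSetDefinable _) X

/-- An assignment of sets to the constants and the variables. -/
structure Asn where
  c : ℕ → ZFSet.{0}
  v : ℕ → ZFSet.{0}

/-- The assignment modified to send the variable `x` to the set `s`. -/
noncomputable def Asn.update (A : Asn) (x : ℕ) (s : ZFSet.{0}) : Asn :=
  ⟨A.c, Function.update A.v x s⟩

/-- The interpretation `⟦·⟧` of terms determined by an assignment:
`⟦ρS⟧ = ∏⟦S⟧`, `⟦βRS⟧ = ⟦R⟧(⟦S⟧)` and `⟦λxRS⟧ = {⟨⟦S⟧_{⟨r,x⟩}, r⟩ : r ∈ ⟦R⟧}`. -/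
noncomputable def interp : Tm → Asn → ZFSet
  | Tm.const a, A => A.c a
  | Tm.var x, A => A.v x
  | Tm.rho R, A => dprod (interp R A)
  | Tm.app R S, A => sApp (interp R A) (interp S A)
  | Tm.lam x R S, A => lamSet (interp R A) (fun r => interp S (A.update x r))

end Paper
namespace Paper

/-- The head α-conversion relation
`≡^α = {⟨λxRS, λyR(S[y/x])⟩ : x ∉ B(S) and y ∉ V(S)}`. -/
def HeadAlpha (A B : Tm) : Prop :=
  ∃ (x y : ℕ) (R S : Tm), x ∉ S.bv ∧ y ∉ S.vars ∧
    A = Tm.lam x R S ∧ B = Tm.lam y R (S.subst (Tm.var y) x)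

end Paper
namespace Paper

/-- The contextual closure of a relation on terms: the smallest relation
containing it such that `R ▷ C` implies `βSR ▷ βSC`, `βRS ▷ βCS`, `λxSR ▷ λxSC`,
`λxRS ▷ λxCS` and `ρR ▷ ρC`. -/
inductive Ctx (r : Tm → Tm → Prop) : Tm → Tm → Prop
  | base {R C : Tm} : r R C → Ctx r R C
  | appLeft {R C S : Tm} : Ctx r R C → Ctx r (Tm.app R S) (Tm.app C S)
  | appRight {R C S : Tm} : Ctx r R C → Ctx r (Tm.app S R) (Tm.app S C)
  | lamDom {R C S : Tm} {x : ℕ} : Ctx r R C → Ctx r (Tm.lam x R S) (Tm.lam x C S)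
  | lamBody {R C S : Tm} {x : ℕ} : Ctx r R C → Ctx r (Tm.lam x S R) (Tm.lam x S C)
  | rho {R C : Tm} : Ctx r R C → Ctx r (Tm.rho R) (Tm.rho C)

/-- α-conversion `≡_α`: the reflexive transitive contextual closure of
head α-conversion. -/
def AlphaEq : Tm → Tm → Prop := Relation.ReflTransGen (Ctx HeadAlpha)

end Paper
namespace Paper

/-- The setoid of α-conversion: the equivalence relation generated by the
contextual closure of head α-conversion (which coincides with `AlphaEq`). -/
def alphaSetoid : Setoid Tm := Relation.EqvGen.setoid (Ctx HeadAlpha)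

/-- α-equivalence classes of terms. -/
def QTm := Quotient alphaSetoid

/-- The α-equivalence class `[T]_α` of a term. -/
def cls (t : Tm) : QTm := Quotient.mk alphaSetoid t

/-- Typing statements `(S : P)`: pairs of α-equivalence classes of terms. -/
abbrev Stmt := QTm × QTm

/-- The free variables of an α-equivalence class, i.e. the union of the free
variables of its representatives (free variables are α-invariant). -/
def Fq (q : QTm) : Set ℕ := {v | ∃ T : Tm, cls T = q ∧ v ∈ T.fv}

/-- The free variables `F(Γ)` of a set of typing statements: the union of the
free variables of the subjects and predicates of its statements. -/
def FSet (Γ : Set Stmt) : Set ℕ := {v | ∃ st ∈ Γ, v ∈ Fq st.1 ∨ v ∈ Fq st.2}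

/-- The product term `πxRS := ρλxRS`. -/
def Tm.pi (x : ℕ) (R S : Tm) : Tm := Tm.rho (Tm.lam x R S)

end Paper
namespace Paper

/-- An interpretation satisfies the typing statement `(S : P)` iff `⟦S⟧ ∈ ⟦P⟧`
(this is independent of the choice of representatives, interpretations being
α-invariant). -/
def QSat (A : Asn) (st : Stmt) : Prop :=
  ∀ S P : Tm, st.1 = cls S → st.2 = cls P → interp S A ∈ interp P A

/-- An interpretation is a model for `Γ` iff it satisfies every statement in `Γ`. -/
def QModels (A : Asn) (Γ : Set Stmt) : Prop := ∀ st ∈ Γ, QSat A st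

/-- The consequence relation `Γ ⊨ X`: every model of `Γ` is a model of `X`. -/
def QConseq (Γ : Set Stmt) (st : Stmt) : Prop :=
  ∀ A : Asn, QModels A Γ → QSat A st

/-- `Γ ⊨ Δ` iff `Γ ⊨ X` for every `X ∈ Δ`. -/
def QConseqSet (Γ Δ : Set Stmt) : Prop := ∀ st ∈ Δ, QConseq Γ st

end Paper
namespace Paper

/-- The inference relation `⊢`: the smallest sequent such that
(App): `{(F : πxPR), (S : P)} ⊢ (βFS : R[S/x])`, and
(Ab): if `x ∉ F(Γ) ∪ F(Q)` and `Γ, (x:Q) ⊢ (S : P)` then `Γ ⊢ (λxQS : πxQP)`.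
The constructors `mem` and `cut` express exactly the sequent property. -/
inductive Derive : Set Stmt → Stmt → Prop
  | mem {Γ : Set Stmt} {st : Stmt} : st ∈ Γ → Derive Γ st
  | cut {Γ Δ : Set Stmt} {st : Stmt} :
      (∀ st' ∈ Δ, Derive Γ st') → Derive Δ st → Derive Γ st
  | app (F S P R : Tm) (x : ℕ) :
      Derive {(cls F, cls (Tm.pi x P R)), (cls S, cls P)}
        (cls (Tm.app F S), cls (R.subst S x))
  | ab {Γ : Set Stmt} (Q S P : Tm) (x : ℕ) :
      x ∉ FSet Γ → x ∉ Q.fv →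
      Derive (Γ ∪ {(cls (Tm.var x), cls Q)}) (cls S, cls P) →
      Derive Γ (cls (Tm.lam x Q S), cls (Tm.pi x Q P))

end Paper

namespace Paper

/-- The interpretation of a term depends only on the constants and the free variables. -/
theorem interp_congr (T : Tm) : ∀ {A B : Asn}, A.c = B.c → (∀ v ∈ T.fv, A.v v = B.v v) →
    interp T A = interp T B := by
  induction T with
  | const a => intro A B hc _; simp [interp, hc]
  | var x => intro A B _ hv; exact hv x (by simp [Tm.fv])
  | rho R ihR => intro A B hc hv; simp only [interp]; rw [ihR hc hv]
  | app R S ihR ihS =>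
    intro A B hc hv
    simp only [interp]
    rw [ihR hc fun v h => hv v (by simp [Tm.fv, h]), ihS hc fun v h => hv v (by simp [Tm.fv, h])]
  | lam x R S ihR ihS =>
    intro A B hc hv
    simp only [interp]
    rw [ihR hc fun v h => hv v (by simp [Tm.fv, h])]
    congr 1
    funext r
    refine ihS hc fun v h => ?_
    by_cases hvx : v = x
    · simp [Asn.update, hvx]
    · simpa [Asn.update, hvx] using hv v (by simp [Tm.fv, h, hvx])

theorem interp_update_of_notMem {T : Tm} {x : ℕ} (hx : x ∉ T.fv) (A : Asn) (s : ZFSet.{0}) :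
    interp T (A.update x s) = interp T A := by
  refine interp_congr T rfl fun v hv => ?_
  have hvx : v ≠ x := fun h => hx (h ▸ hv)
  simp [Asn.update, hvx]

theorem interp_renameAux (n : ℕ) : ∀ (S : Tm) (h : S.size ≤ n) (z y : ℕ) (A : Asn),
    interp (Tm.renameAux n S h z y).1 A = interp S (A.update y (A.v z)) := by
  induction n with
  | zero => intro S h; cases S <;> simp [Tm.size] at h
  | succ n ih =>
    intro S h z y A
    cases S with
    | const a => simp [Tm.renameAux, interp, Asn.update]
    | var v =>
      by_cases hv : v = y <;> simp [Tm.renameAux, interp, Asn.update, hv]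
    | rho R => simp [Tm.renameAux, interp, ih]
    | app R S => simp [Tm.renameAux, interp, ih]
    | lam w R S =>
      simp only [Tm.renameAux]
      split_ifs with h1 h2
      · simp only [interp, ih]
        congr 1
        funext r
        refine interp_congr S rfl fun v hv => ?_
        simp only [Asn.update, Function.update_apply]
        grind
      · simp only [interp, ih]
        congr 1
        funext r
        refine interp_congr S rfl fun v hv => ?_
        simp only [Asn.update, Function.update_apply]
        grind
      · have hz := Tm.fresh_not_mem ((Tm.var z).vars ∪ S.vars)
        simp only [interp, ih]
        generalize Tm.fresh ((Tm.var z).vars ∪ S.vars) = z' at hz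
        simp only [Tm.vars, Tm.fv, Finset.mem_union, Finset.mem_singleton, not_or] at hz
        congr 1
        funext r
        refine interp_congr S rfl fun v hv => ?_
        simp only [Asn.update, Function.update_apply]
        grind

theorem interp_rename (S : Tm) (z y : ℕ) (A : Asn) :
    interp (S.rename z y) A = interp S (A.update y (A.v z)) :=
  interp_renameAux _ _ _ _ _ _

/-- The substitution lemma. -/
theorem interp_subst (S T : Tm) (x : ℕ) (A : Asn) :
    interp (S.subst T x) A = interp S (A.update x (interp T A)) := by
  induction hn : S.size using Nat.strong_induction_on generalizing S A with
  | _ n ih =>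
    cases S with
    | const a => simp [Tm.subst, interp, Asn.update]
    | var v => by_cases hv : v = x <;> simp [Tm.subst, interp, Asn.update, hv]
    | rho R =>
      simp only [Tm.size] at hn
      simp only [Tm.subst, interp]
      rw [ih R.size (by omega) R A rfl]
    | app R S =>
      simp only [Tm.size] at hn
      simp only [Tm.subst, interp]
      rw [ih R.size (by omega) R A rfl, ih S.size (by omega) S A rfl]
    | lam w R S =>
      simp only [Tm.size] at hn
      rw [Tm.subst]
      split_ifs with h1 h2
      · simp only [interp]
        rw [ih R.size (by omega) R A rfl]
        congr 1
        funext r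
        refine interp_congr S rfl fun v hv => ?_
        simp only [Asn.update, Function.update_apply]
        grind
      · have hz := Tm.fresh_not_mem (T.vars ∪ S.vars)
        generalize Tm.fresh (T.vars ∪ S.vars) = z at hz
        simp only [Tm.vars, Finset.mem_union, not_or] at hz
        simp only [interp]
        rw [ih R.size (by omega) R A rfl]
        congr 1
        funext r
        rw [ih S.size (by omega) _ _ (Tm.size_rename S z w), interp_rename,
          interp_update_of_notMem hz.1.1]
        refine interp_congr S rfl fun v hv => ?_
        simp only [Asn.update, Function.update_apply]
        grind
      · simp only [interp]
        rw [ih R.size (by omega) R A rfl]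
        congr 1
        funext r
        rw [ih S.size (by omega) S _ rfl, interp_update_of_notMem h2]
        refine interp_congr S rfl fun v hv => ?_
        simp only [Asn.update, Function.update_apply]
        grind

theorem HeadAlpha.interp_eq {S T : Tm} (h : HeadAlpha S T) (A : Asn) :
    interp S A = interp T A := by
  obtain ⟨x, y, R, S, -, hy, rfl, rfl⟩ := h
  simp only [Tm.vars, Finset.mem_union, not_or] at hy
  simp only [interp, interp_subst]
  congr 1
  funext r
  refine interp_congr S rfl fun v hv => ?_
  simp only [Asn.update, Function.update_apply]
  grind

theorem Ctx.interp_eq {S T : Tm} (h : Ctx HeadAlpha S T) :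
    ∀ A : Asn, interp S A = interp T A := by
  induction h with
  | base h => exact h.interp_eq
  | appLeft _ ih | appRight _ ih | lamDom _ ih | lamBody _ ih | rho _ ih =>
    intro A; simp only [interp, ih]

theorem interp_eq_of_cls_eq {S T : Tm} (h : cls S = cls T) (A : Asn) :
    interp S A = interp T A := by
  have h' : Relation.EqvGen (Ctx HeadAlpha) S T := Quotient.exact h
  induction h' with
  | rel _ _ hc => exact hc.interp_eq A
  | refl => rfl
  | symm _ _ hh ih => exact (ih (Quotient.sound hh)).symm
  | trans _ _ _ h₁ h₂ ih₁ ih₂ => exact (ih₁ (Quotient.sound h₁)).trans (ih₂ (Quotient.sound h₂))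

theorem qSat_cls_iff {A : Asn} {S P : Tm} :
    QSat A (cls S, cls P) ↔ interp S A ∈ interp P A := by
  refine ⟨fun h => h S P rfl rfl, fun h S' P' hS hP => ?_⟩
  rwa [← interp_eq_of_cls_eq hS, ← interp_eq_of_cls_eq hP]

theorem mem_sUnion_sUnion_of_pair_mem {r d F : ZFSet.{0}} (h : ZFSet.pair r d ∈ F) :
    r ∈ F.sUnion.sUnion ∧ d ∈ F.sUnion.sUnion := by
  have hp : ({r, d} : ZFSet) ∈ F.sUnion :=
    ZFSet.mem_sUnion.2 ⟨_, h, by simp [ZFSet.pair]⟩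
  exact ⟨ZFSet.mem_sUnion.2 ⟨_, hp, by simp⟩, ZFSet.mem_sUnion.2 ⟨_, hp, by simp⟩⟩

theorem mem_sDom {F d : ZFSet.{0}} : d ∈ sDom F ↔ ∃ r, ZFSet.pair r d ∈ F := by
  simp only [sDom, ZFSet.mem_sep, and_iff_right_iff_imp]
  exact fun ⟨_, h⟩ => (mem_sUnion_sUnion_of_pair_mem h).2

theorem mem_sRan {F r : ZFSet.{0}} : r ∈ sRan F ↔ ∃ d, ZFSet.pair r d ∈ F := by
  simp only [sRan, ZFSet.mem_sep, and_iff_right_iff_imp]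
  exact fun ⟨_, h⟩ => (mem_sUnion_sUnion_of_pair_mem h).1

theorem mem_sApp {F s t : ZFSet.{0}} : t ∈ sApp F s ↔ ∃ r, ZFSet.pair r s ∈ F ∧ t ∈ r := by
  rw [sApp, ZFSet.mem_sUnion]
  simp only [ZFSet.mem_sep]
  exact ⟨fun ⟨r, h, ht⟩ => ⟨r, h.2, ht⟩,
    fun ⟨r, h, ht⟩ => ⟨r, ⟨(mem_sUnion_sUnion_of_pair_mem h).1, h⟩, ht⟩⟩

theorem mem_lamSet {X p : ZFSet.{0}} {f : ZFSet.{0} → ZFSet.{0}} :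
    p ∈ lamSet X f ↔ ∃ r ∈ X, ZFSet.pair (f r) r = p := by
  let _ := Classical.allZFSetDefinable fun a : Fin 1 → ZFSet.{0} => ZFSet.pair (f (a 0)) (a 0)
  exact ZFSet.mem_image

theorem pair_mem_lamSet {X r d : ZFSet.{0}} {f : ZFSet.{0} → ZFSet.{0}} :
    ZFSet.pair r d ∈ lamSet X f ↔ d ∈ X ∧ r = f d := by
  simp only [mem_lamSet, ZFSet.pair_inj]
  constructor
  · rintro ⟨_, h, rfl, rfl⟩; exact ⟨h, rfl⟩
  · rintro ⟨h, rfl⟩; exact ⟨d, h, rfl, rfl⟩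

theorem sDom_lamSet (X : ZFSet.{0}) (f : ZFSet.{0} → ZFSet.{0}) : sDom (lamSet X f) = X := by
  ext d
  simp [mem_sDom, pair_mem_lamSet]

theorem sApp_lamSet {X s : ZFSet.{0}} (f : ZFSet.{0} → ZFSet.{0}) (hs : s ∈ X) :
    sApp (lamSet X f) s = f s := by
  ext t
  simp [mem_sApp, pair_mem_lamSet, hs]

theorem isFun_lamSet (X : ZFSet.{0}) (f : ZFSet.{0} → ZFSet.{0}) : IsFun (lamSet X f) := by
  refine ⟨fun p hp => ?_, fun d r r' h h' => ?_⟩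
  · obtain ⟨r, -, rfl⟩ := mem_lamSet.1 hp
    exact ⟨_, _, rfl⟩
  · exact (pair_mem_lamSet.1 h).2.trans (pair_mem_lamSet.1 h').2.symm

theorem lamSet_mem_dprod {X : ZFSet.{0}} {f g : ZFSet.{0} → ZFSet.{0}}
    (h : ∀ r ∈ X, f r ∈ g r) : lamSet X f ∈ dprod (lamSet X g) := by
  simp only [dprod, ZFSet.mem_sep, ZFSet.mem_powerset, sDom_lamSet]
  refine ⟨fun p hp => ?_, isFun_lamSet X f, trivial, fun d hd => ?_⟩
  · obtain ⟨r, hr, rfl⟩ := mem_lamSet.1 hp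
    exact ZFSet.pair_mem_prod.2
      ⟨ZFSet.mem_sUnion.2 ⟨g r, mem_sRan.2 ⟨r, pair_mem_lamSet.2 ⟨hr, rfl⟩⟩, h r hr⟩, hr⟩
  · rw [sApp_lamSet f hd, sApp_lamSet g hd]
    exact h d hd

theorem sApp_mem_of_mem_dprod {X F s : ZFSet.{0}} {g : ZFSet.{0} → ZFSet.{0}}
    (hF : F ∈ dprod (lamSet X g)) (hs : s ∈ X) : sApp F s ∈ g s := by
  simp only [dprod, ZFSet.mem_sep, sDom_lamSet] at hF
  simpa only [sApp_lamSet g hs] using hF.2.2.2 s hs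

theorem QModels.update {A : Asn} {Γ : Set Stmt} (hA : QModels A Γ) {x : ℕ} (hx : x ∉ FSet Γ)
    (s : ZFSet.{0}) : QModels (A.update x s) Γ := by
  intro st hst S P hS hP
  rw [interp_update_of_notMem fun h => hx ⟨st, hst, Or.inl ⟨S, hS.symm, h⟩⟩,
    interp_update_of_notMem fun h => hx ⟨st, hst, Or.inr ⟨P, hP.symm, h⟩⟩]
  exact hA st hst S P hS hP

/-- soundness of the bare bones system, `⊢ ⊆ ⊨`. -/
theorem derive_sound (Γ : Set Stmt) (st : Stmt) :
    Derive Γ st → QConseq Γ st := by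
  intro h
  induction h with
  | mem h => exact fun A hA => hA _ h
  | cut _ _ ih₁ ih₂ => exact fun A hA => ih₂ A fun st' hst' => ih₁ st' hst' A hA
  | app F S P R x =>
    intro A hA
    have hF := qSat_cls_iff.1 (hA (cls F, cls (Tm.pi x P R)) (by simp))
    have hS := qSat_cls_iff.1 (hA (cls S, cls P) (by simp))
    rw [qSat_cls_iff, interp_subst]
    exact sApp_mem_of_mem_dprod hF hS
  | ab Q S P x hΓ hQ _ ih =>
    intro A hA
    refine qSat_cls_iff.2 (lamSet_mem_dprod fun r hr => qSat_cls_iff.1 (ih _ ?_))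
    rintro st (hst | rfl)
    · exact hA.update hΓ r st hst
    · rw [qSat_cls_iff, interp_update_of_notMem hQ]
      simpa [interp, Asn.update] using hr

end Paper
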